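/- arXiv:2208.05166 — 3 statements merged into one kernel-verified Lean document; each statement's English description precedes it below -/
import Mathlib

section
/- Let ρ > 0, σ > 0 and 0 < z < 1. Then Σ_{k=1}^∞ z^k · Σ_{m=0}^∞ (σ/(m+σ+ρ)) · p_{k−1}(m) = σ·z·e^{ρz(1−z)} · Σ_{n=0}^∞ (1/(σ+ρ+n−ρz²)) · (−ρz(1−z))^n/n!. (The left-hand side is the probability generating function of the random variable κ(σ), the number of arrivals and departures in an initially empty M/M/∞ system until an exp(σ)-distributed observation period ends.) -/
/-- `p_k(m)`: probability that the absorbed discrete-time chain of the `M/M/∞` queue observed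
during an `exp(σ)` time, started empty, is in state `m` after `k` transitions without having
been absorbed. -/
noncomputable def pchain (ρ σ : ℝ) : ℕ → ℕ → ℝ
  | 0, m => if m = 0 then 1 else 0
  | k + 1, m =>
      (if 1 ≤ m then pchain ρ σ k (m - 1) * ρ / (((m : ℝ) - 1) + σ + ρ) else 0) +
        pchain ρ σ k (m + 1) * ((m : ℝ) + 1) / (((m : ℝ) + 1) + σ + ρ)

open Real Set

/-- Termwise differentiation of a power series with geometrically bounded coefficients. -/
theorem hasDerivAt_tsum_mul_pow {a : ℕ → ℝ} {C q x : ℝ} (hq : 0 < q)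
    (ha : ∀ n, |a n| ≤ C * q ^ n) (hx : |x| * q < 1) :
    Summable (fun n => a n * x ^ n) ∧ Summable (fun n : ℕ => (n + 1) * a (n + 1) * x ^ n) ∧
      HasDerivAt (fun y => ∑' n, a n * y ^ n) (∑' n : ℕ, (n + 1) * a (n + 1) * x ^ n) x := by
  obtain ⟨r, hxr, hr⟩ : ∃ r, |x| < r ∧ r < 1 / q :=
    exists_between (by rwa [lt_div_iff₀ hq])
  have hr0 : 0 < r := (abs_nonneg x).trans_lt hxr
  have hqr : q * r < 1 := by rwa [lt_div_iff₀ hq, mul_comm] at hr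
  have hqr0 : 0 < q * r := mul_pos hq hr0
  have hC : 0 ≤ C := by simpa using (abs_nonneg _).trans (ha 0)
  have hsum : ∀ y, |y| < r → Summable (fun n => a n * y ^ n) := by
    intro y hy
    refine Summable.of_norm_bounded
      ((summable_geometric_of_lt_one hqr0.le hqr).mul_left C) fun n => ?_
    rw [norm_mul, norm_pow, Real.norm_eq_abs, Real.norm_eq_abs, mul_pow, ← mul_assoc]
    exact mul_le_mul (ha n) (pow_le_pow_left₀ (abs_nonneg _) hy.le n) (by positivity)
      (by positivity)
  have hbound : ∀ (n : ℕ) (y : ℝ), |y| < r →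
      ‖a n * (n * y ^ (n - 1))‖ ≤ C / r * ((n : ℝ) ^ 1 * (q * r) ^ n) := by
    intro n y hy
    rcases n with _ | n
    · simp
    · have h1 : ‖a (n + 1) * ((n + 1 : ℕ) * y ^ (n + 1 - 1))‖ =
          |a (n + 1)| * (((n + 1 : ℕ) : ℝ) * |y| ^ n) := by
        simp only [norm_mul, norm_pow, Real.norm_eq_abs, Nat.abs_cast, Nat.add_sub_cancel]
      have h2 : C / r * (((n + 1 : ℕ) : ℝ) ^ 1 * (q * r) ^ (n + 1)) =
          C * q ^ (n + 1) * (((n + 1 : ℕ) : ℝ) * r ^ n) := by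
        rw [mul_pow, pow_one]
        field_simp
        ring
      rw [h1, h2]
      have := ha (n + 1)
      gcongr
  have hu : Summable (fun n : ℕ => C / r * ((n : ℝ) ^ 1 * (q * r) ^ n)) := by
    have hn : ‖q * r‖ < 1 := by rwa [Real.norm_of_nonneg hqr0.le]
    exact (summable_pow_mul_geometric_of_norm_lt_one (R := ℝ) 1 hn).mul_left (C / r)
  have hd : Summable (fun n : ℕ => a n * (n * x ^ (n - 1))) :=
    Summable.of_norm_bounded hu fun n => hbound n x hxr
  have hd' : Summable (fun n : ℕ => (n + 1) * a (n + 1) * x ^ n) :=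
    ((summable_nat_add_iff 1).2 hd).congr fun n => by
      simp only [Nat.add_sub_cancel]; push_cast; ring
  refine ⟨hsum x hxr, hd', ?_⟩
  have key := hasDerivAt_tsum_of_isPreconnected (t := Ioo (-r) r)
    (g := fun n y => a n * y ^ n) (g' := fun (n : ℕ) y => a n * (n * y ^ (n - 1))) hu isOpen_Ioo
    isPreconnected_Ioo (fun n y _ => (hasDerivAt_pow n y).const_mul (a n))
    (fun n y hy => hbound n y (abs_lt.2 hy)) (y₀ := x) (y := x) (abs_lt.1 hxr) (hsum x hxr)
    (abs_lt.1 hxr)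
  refine key.congr_deriv ?_
  rw [hd.tsum_eq_zero_add]
  simp only [Nat.cast_zero, zero_mul, mul_zero, zero_add, Nat.add_sub_cancel]
  exact tsum_congr fun n => by push_cast; ring

/-- The equation `u E' + (c - b u) E = 0` with `c > 0` has no nonzero solution that is
regular at `0`. -/
theorem eq_zero_of_regular_singular {E E' : ℝ → ℝ} {b c v : ℝ} (hc : 0 < c) (hv : 0 < v)
    (hE : ∀ u ∈ Icc 0 v, HasDerivAt E (E' u) u)
    (heq : ∀ u ∈ Icc 0 v, u * E' u + (c - b * u) * E u = 0) : E v = 0 := by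
  have hderiv : ∀ u ∈ Ioo 0 v,
      HasDerivAt (fun u => u ^ c * (exp (-(b * u)) * E u)) 0 u := by
    intro u hu
    have hu0 : u ≠ 0 := hu.1.ne'
    have h1 := Real.hasDerivAt_rpow_const (p := c) (Or.inl hu0)
    have h2 : HasDerivAt (fun u => exp (-(b * u))) (exp (-(b * u)) * -(b * 1)) u :=
      (((hasDerivAt_id u).const_mul b).neg).exp
    refine (h1.mul (h2.mul (hE u (Ioo_subset_Icc_self hu)))).congr_deriv ?_
    have h3 : u ^ c = u ^ (c - 1) * u := by
      rw [Real.rpow_sub_one hu0, div_mul_cancel₀ _ hu0]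
    simp only [Pi.mul_apply, h3]
    linear_combination (u ^ (c - 1) * exp (-(b * u))) * heq u (Ioo_subset_Icc_self hu)
  have hcont : ContinuousOn (fun u => u ^ c * (exp (-(b * u)) * E u)) (Icc 0 v) := by
    have hE' : ContinuousOn E (Icc 0 v) := fun u hu => (hE u hu).continuousAt.continuousWithinAt
    refine (continuous_id.rpow_const fun _ => Or.inr hc.le).continuousOn.mul
      (ContinuousOn.mul ?_ hE')
    fun_prop
  obtain ⟨ξ, -, hξ⟩ := exists_hasDerivAt_eq_slope _ (fun _ => 0) hv hcont hderiv
  rw [eq_comm, div_eq_zero_iff, Real.zero_rpow hc.ne', zero_mul, sub_zero, sub_zero] at hξ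
  simpa [hv.ne', (Real.rpow_pos_of_pos hv c).ne', (exp_pos _).ne'] using hξ

theorem pchain_nonneg {ρ σ : ℝ} (hρ : 0 < ρ) (hσ : 0 < σ) (k m : ℕ) : 0 ≤ pchain ρ σ k m := by
  induction k generalizing m with
  | zero => unfold pchain; split_ifs <;> norm_num
  | succ k ih =>
    have h1 := ih (m - 1)
    have h2 := ih (m + 1)
    unfold pchain
    refine add_nonneg ?_ (by positivity)
    split_ifs with hm
    · have : (1 : ℝ) ≤ m := by exact_mod_cast hm
      have : 0 < (m : ℝ) - 1 + σ + ρ := by linarith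
      positivity
    · exact le_rfl

theorem pchain_eq_zero {ρ σ : ℝ} {k m : ℕ} (h : k < m) : pchain ρ σ k m = 0 := by
  induction k generalizing m with
  | zero => unfold pchain; rw [if_neg (by lia)]
  | succ k ih =>
    unfold pchain
    rw [ih (m := m - 1) (by lia), ih (m := m + 1) (by lia)]
    simp

theorem pchain_succ_zero (ρ σ : ℝ) (k : ℕ) :
    pchain ρ σ (k + 1) 0 = pchain ρ σ k 1 / (1 + σ + ρ) := by
  simp [pchain]

theorem pchain_succ_succ (ρ σ : ℝ) (k m : ℕ) :
    pchain ρ σ (k + 1) (m + 1) = ρ * (pchain ρ σ k m / (m + σ + ρ)) +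
      (m + 2) * (pchain ρ σ k (m + 2) / ((m + 2 : ℕ) + σ + ρ)) := by
  rw [pchain, if_pos (by lia)]
  simp only [Nat.add_sub_cancel]
  push_cast
  ring_nf

theorem sum_pchain_le_one {ρ σ : ℝ} (hρ : 0 < ρ) (hσ : 0 < σ) (k N : ℕ) :
    ∑ m ∈ Finset.range N, pchain ρ σ k m ≤ 1 := by
  induction k generalizing N with
  | zero =>
    simp only [pchain, Finset.sum_ite_eq']
    split_ifs <;> norm_num
  | succ k ih =>
    have hp := pchain_nonneg hρ hσ
    have hr : ∀ n : ℕ, 0 ≤ pchain ρ σ k n / (n + σ + ρ) := fun n =>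
      div_nonneg (hp k n) (by positivity)
    have hpr : ∀ n : ℕ, (n + ρ) * (pchain ρ σ k n / (n + σ + ρ)) ≤ pchain ρ σ k n := by
      intro n
      have : 0 < (n : ℝ) + σ + ρ := by positivity
      rw [← mul_div_assoc, div_le_iff₀ this]
      nlinarith [hp k n]
    have key : ∀ n : ℕ, ∑ m ∈ Finset.range (n + 1), pchain ρ σ (k + 1) m +
          ρ * (pchain ρ σ k n / (n + σ + ρ)) ≤
        ∑ m ∈ Finset.range (n + 1), pchain ρ σ k m +
          (n + 1 : ℕ) * (pchain ρ σ k (n + 1) / ((n + 1 : ℕ) + σ + ρ)) := by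
      intro n
      induction n with
      | zero =>
        have h := hpr 0
        simp only [zero_add, Finset.sum_range_one, pchain_succ_zero, Nat.cast_one, one_mul,
          Nat.cast_zero] at h ⊢
        linarith
      | succ n ihn =>
        have h := hpr (n + 1)
        rw [Finset.sum_range_succ, Finset.sum_range_succ _ (n + 1), pchain_succ_succ]
        have h2 : ((n + 1 + 1 : ℕ) : ℝ) = n + 2 := by push_cast; ring
        simp only [h2] at ihn ⊢
        linarith
    rcases N with _ | n
    · simp
    · have h1 := ih (n + 2)
      rw [Finset.sum_range_succ] at h1
      have h2 := mul_nonneg hρ.le (hr n)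
      have h3 := mul_nonneg hρ.le (hr (n + 1))
      linarith [key n, hpr (n + 1)]

theorem pchain_le_one {ρ σ : ℝ} (hρ : 0 < ρ) (hσ : 0 < σ) (k m : ℕ) : pchain ρ σ k m ≤ 1 :=
  (Finset.single_le_sum (fun i _ => pchain_nonneg hρ hσ k i) (Finset.self_mem_range_succ m)).trans
    (sum_pchain_le_one hρ hσ k (m + 1))

/-- The coefficients `z ^ k p_k(m) / (m + σ + ρ)` are dominated by a double geometric sequence. -/
theorem pow_mul_pchain_div_le {ρ σ w : ℝ} (hρ : 0 < ρ) (hσ : 0 < σ) (hw0 : 0 < w) (hw1 : w < 1)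
    (k m : ℕ) :
    (w ^ 2) ^ k * (pchain ρ σ k m / (m + σ + ρ)) ≤ (σ + ρ)⁻¹ * (w ^ k * w ^ m) := by
  rcases lt_or_ge k m with h | h
  · rw [pchain_eq_zero h]
    simp only [zero_div, mul_zero]
    positivity
  · have h1 : pchain ρ σ k m / (m + σ + ρ) ≤ (σ + ρ)⁻¹ := by
      rw [← one_div]
      exact div_le_div₀ zero_le_one (pchain_le_one hρ hσ k m) (by positivity)
        (by linarith [Nat.cast_nonneg (α := ℝ) m])
    have h2 : (w ^ 2) ^ k ≤ w ^ k * w ^ m := by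
      rw [← pow_mul, two_mul, pow_add]
      exact mul_le_mul_of_nonneg_left (pow_le_pow_of_le_one hw0.le hw1.le h) (by positivity)
    rw [mul_comm]
    exact mul_le_mul h1 h2 (by positivity) (by positivity)

/-- Coefficient in `x ^ m` of `∑ z ^ k p_k(m) x ^ m / (m + σ + ρ)`. -/
noncomputable def chainCoeff (ρ σ z : ℝ) (m : ℕ) : ℝ :=
  ∑' k : ℕ, z ^ k * (pchain ρ σ k m / (m + σ + ρ))

section chainCoeff

variable {ρ σ z : ℝ}

theorem summable_pow_mul_pchain_div (hρ : 0 < ρ) (hσ : 0 < σ) (hz0 : 0 < z) (hz1 : z < 1) :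
    Summable (fun x : ℕ × ℕ => z ^ x.1 * (pchain ρ σ x.1 x.2 / (x.2 + σ + ρ))) := by
  have hw0 : 0 < √z := Real.sqrt_pos.2 hz0
  have hw1 : √z < 1 := by rw [Real.sqrt_lt' one_pos]; simpa
  have hg := summable_geometric_of_lt_one hw0.le hw1
  have hdom := (hg.mul_of_nonneg hg (fun _ => by positivity) (fun _ => by positivity)).mul_left
    (σ + ρ)⁻¹
  refine Summable.of_nonneg_of_le (fun x => ?_) (fun x => ?_) hdom
  · have := pchain_nonneg hρ hσ x.1 x.2
    positivity
  · simpa [Real.sq_sqrt hz0.le] using pow_mul_pchain_div_le hρ hσ hw0 hw1 x.1 x.2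

theorem abs_chainCoeff_le (hρ : 0 < ρ) (hσ : 0 < σ) (hz0 : 0 < z) (hz1 : z < 1) (m : ℕ) :
    |chainCoeff ρ σ z m| ≤ (σ + ρ)⁻¹ * (1 - √z)⁻¹ * √z ^ m := by
  have hw0 : 0 < √z := Real.sqrt_pos.2 hz0
  have hw1 : √z < 1 := by rw [Real.sqrt_lt' one_pos]; simpa
  have h := ((hasSum_geometric_of_lt_one hw0.le hw1).mul_right (√z ^ m)).mul_left (σ + ρ)⁻¹
  rw [mul_assoc]
  rw [chainCoeff, ← Real.norm_eq_abs]
  refine tsum_of_norm_bounded h fun k => ?_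
  have hnn : 0 ≤ z ^ k * (pchain ρ σ k m / (m + σ + ρ)) := by
    have := pchain_nonneg hρ hσ k m
    positivity
  rw [Real.norm_of_nonneg hnn]
  simpa [Real.sq_sqrt hz0.le] using pow_mul_pchain_div_le hρ hσ hw0 hw1 k m

theorem summable_chainCoeff_terms (hρ : 0 < ρ) (hσ : 0 < σ) (hz0 : 0 < z) (hz1 : z < 1) (m : ℕ) :
    Summable (fun k : ℕ => z ^ k * (pchain ρ σ k m / (m + σ + ρ))) :=
  (summable_pow_mul_pchain_div hρ hσ hz0 hz1).prod_symm.prod_factor m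

theorem mul_chainCoeff (hρ : 0 < ρ) (hσ : 0 < σ) (hz0 : 0 < z) (hz1 : z < 1) (m : ℕ) :
    (m + σ + ρ) * chainCoeff ρ σ z m =
      pchain ρ σ 0 m + ∑' k : ℕ, z ^ (k + 1) * pchain ρ σ (k + 1) m := by
  have hm : (m : ℝ) + σ + ρ ≠ 0 := by positivity
  have h : ∀ k, (m + σ + ρ) * (z ^ k * (pchain ρ σ k m / (m + σ + ρ))) =
      z ^ k * pchain ρ σ k m := fun k => by field_simp
  have hs := (summable_chainCoeff_terms hρ hσ hz0 hz1 m).mul_left (m + σ + ρ)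
  rw [chainCoeff, ← tsum_mul_left, hs.tsum_eq_zero_add]
  simp only [h]
  rw [pow_zero, one_mul]

theorem chainCoeff_zero (hρ : 0 < ρ) (hσ : 0 < σ) (hz0 : 0 < z) (hz1 : z < 1) :
    (σ + ρ) * chainCoeff ρ σ z 0 = 1 + z * chainCoeff ρ σ z 1 := by
  have h := mul_chainCoeff hρ hσ hz0 hz1 0
  rw [Nat.cast_zero, zero_add] at h
  rw [h, chainCoeff, ← tsum_mul_left]
  congr 1
  exact tsum_congr fun k => by rw [pchain_succ_zero, Nat.cast_one]; ring

theorem chainCoeff_succ (hρ : 0 < ρ) (hσ : 0 < σ) (hz0 : 0 < z) (hz1 : z < 1) (m : ℕ) :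
    (m + 1 + σ + ρ) * chainCoeff ρ σ z (m + 1) =
      z * ρ * chainCoeff ρ σ z m + z * ((m + 2) * chainCoeff ρ σ z (m + 2)) := by
  have h := mul_chainCoeff hρ hσ hz0 hz1 (m + 1)
  rw [Nat.cast_add_one] at h
  have h1 := (summable_chainCoeff_terms hρ hσ hz0 hz1 m).mul_left (z * ρ)
  have h2 := (summable_chainCoeff_terms hρ hσ hz0 hz1 (m + 2)).mul_left (z * (m + 2))
  rw [h, ← mul_assoc z, chainCoeff, chainCoeff, ← tsum_mul_left, ← tsum_mul_left,
    ← h1.tsum_add h2]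
  simp only [pchain, Nat.succ_ne_zero, if_false, zero_add]
  exact tsum_congr fun k => by
    have := pchain_succ_succ ρ σ k m
    rw [pchain] at this
    rw [this]; ring

/-- The generating function of `chainCoeff` solves a linear differential equation with a regular
singular point at `z`. -/
theorem exists_hasDerivAt_chainCoeff (hρ : 0 < ρ) (hσ : 0 < σ) (hz0 : 0 < z) (hz1 : z < 1)
    {x : ℝ} (hx : |x| ≤ 1) :
    ∃ D, HasDerivAt (fun y => ∑' m, chainCoeff ρ σ z m * y ^ m) D x ∧
      (x - z) * D + (σ + ρ - ρ * z * x) * ∑' m, chainCoeff ρ σ z m * x ^ m = 1 := by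
  have hw0 : 0 < √z := Real.sqrt_pos.2 hz0
  have hw1 : √z < 1 := by rw [Real.sqrt_lt' one_pos]; simpa
  obtain ⟨hs, hs', hd⟩ := hasDerivAt_tsum_mul_pow hw0 (abs_chainCoeff_le hρ hσ hz0 hz1)
    (x := x) (by nlinarith)
  refine ⟨_, hd, ?_⟩
  have e1 := hs.tsum_eq_zero_add
  have e2 := hs'.tsum_eq_zero_add
  have hs1 := (summable_nat_add_iff 1).2 hs
  have hs1' := (summable_nat_add_iff 1).2 hs'
  have e3 : (σ + ρ) * ∑' n, chainCoeff ρ σ z (n + 1) * x ^ (n + 1) +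
      x * ∑' n : ℕ, (n + 1) * chainCoeff ρ σ z (n + 1) * x ^ n =
      z * ρ * x * ∑' n, chainCoeff ρ σ z n * x ^ n +
      z * ∑' n : ℕ, ((n + 1 : ℕ) + 1) * chainCoeff ρ σ z (n + 1 + 1) * x ^ (n + 1) := by
    simp only [← tsum_mul_left]
    rw [← (hs1.mul_left _).tsum_add (hs'.mul_left _), ← (hs.mul_left _).tsum_add (hs1'.mul_left _)]
    refine tsum_congr fun n => ?_
    push_cast
    linear_combination x ^ (n + 1) * chainCoeff_succ hρ hσ hz0 hz1 n
  simp only [Nat.cast_zero, zero_add, pow_zero, mul_one, one_mul] at e1 e2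
  linear_combination e3 + (σ + ρ) * e1 - z * e2 + chainCoeff_zero hρ hσ hz0 hz1

end chainCoeff

/-- The series `∑ (-b u) ^ n / (n! (c + n))` solves `u H' + c H = exp (-b u)`. -/
theorem exists_hasDerivAt_exp_series {b c u : ℝ} (hc : 0 < c) (hu : |u| < 1) :
    ∃ D, HasDerivAt (fun y => ∑' n : ℕ, (-b) ^ n / n.factorial / (c + n) * y ^ n) D u ∧
      u * D + c * ∑' n : ℕ, (-b) ^ n / n.factorial / (c + n) * u ^ n = exp (-(b * u)) := by
  have hbound : ∀ n : ℕ, |(-b) ^ n / n.factorial / (c + n)| ≤ exp |b| / c * 1 ^ n := by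
    intro n
    have hcn : 0 < c + n := by positivity
    rw [abs_div, abs_div, abs_pow, abs_neg, Nat.abs_cast, abs_of_pos hcn, one_pow, mul_one]
    exact div_le_div₀ (exp_pos _).le (Real.pow_div_factorial_le_exp _ (abs_nonneg b) n) hc
      (by linarith [Nat.cast_nonneg (α := ℝ) n])
  obtain ⟨hs, hs', hd⟩ := hasDerivAt_tsum_mul_pow one_pos hbound (x := u) (by simpa using hu)
  refine ⟨_, hd, ?_⟩
  have hexp := NormedSpace.expSeries_div_hasSum_exp (𝔸 := ℝ) (-(b * u))
  rw [← Real.exp_eq_exp_ℝ] at hexp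
  have hes := hexp.summable
  have he := hexp.tsum_eq
  rw [hes.tsum_eq_zero_add] at he
  have e1 := hs.tsum_eq_zero_add
  have hs1 := (summable_nat_add_iff 1).2 hs
  have e3 : c * ∑' n : ℕ, (-b) ^ (n + 1) / (n + 1).factorial / (c + (n + 1 : ℕ)) * u ^ (n + 1) +
      u * ∑' n : ℕ, (n + 1) * ((-b) ^ (n + 1) / (n + 1).factorial / (c + (n + 1 : ℕ))) * u ^ n =
      ∑' n : ℕ, (-(b * u)) ^ (n + 1) / (n + 1).factorial := by
    simp only [← tsum_mul_left]
    rw [← (hs1.mul_left _).tsum_add (hs'.mul_left _)]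
    refine tsum_congr fun n => ?_
    have hcn : c + (n + 1 : ℕ) ≠ 0 := by positivity
    rw [← neg_mul, mul_pow]
    field_simp
    push_cast
    ring
  simp only [pow_zero, Nat.factorial_zero, Nat.cast_zero, Nat.cast_one, div_one, add_zero,
    mul_one] at e1 he
  have hc1 : c * (1 / c) = 1 := mul_one_div_cancel hc.ne'
  linear_combination e3 + c * e1 + he + hc1

theorem tsum_chainCoeff {ρ σ z : ℝ} (hρ : 0 < ρ) (hσ : 0 < σ) (hz0 : 0 < z) (hz1 : z < 1) :
    ∑' m, chainCoeff ρ σ z m = exp (ρ * z * (1 - z)) *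
      ∑' n : ℕ, 1 / (σ + ρ + n - ρ * z ^ 2) * (-(ρ * z * (1 - z))) ^ n / n.factorial := by
  have hc : 0 < σ + ρ - ρ * z ^ 2 := by nlinarith [mul_pos hρ (sub_pos.2 hz1)]
  choose! F' hF hF' using fun (x : ℝ) (hx : |x| ≤ 1) =>
    exists_hasDerivAt_chainCoeff hρ hσ hz0 hz1 hx
  choose! H' hH hH' using fun (u : ℝ) (hu : |u| < 1) =>
    exists_hasDerivAt_exp_series (b := ρ * z) hc hu
  set F : ℝ → ℝ := fun x => ∑' m, chainCoeff ρ σ z m * x ^ m with hFdef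
  set H : ℝ → ℝ := fun u => ∑' n : ℕ, (-(ρ * z)) ^ n / n.factorial /
    (σ + ρ - ρ * z ^ 2 + n) * u ^ n
  have habs : ∀ u ∈ Icc 0 (1 - z), |z + u| ≤ 1 ∧ |u| < 1 := fun u hu =>
    ⟨abs_le.2 ⟨by linarith [hu.1], by linarith [hu.2]⟩,
      abs_lt.2 ⟨by linarith [hu.1], by linarith [hu.2]⟩⟩
  have hzero := eq_zero_of_regular_singular (b := ρ * z) hc (sub_pos.2 hz1)
    (E := fun u => F (z + u) - exp (ρ * z * u) * H u)
    (E' := fun u => F' (z + u) - (exp (ρ * z * u) * (ρ * z * 1) * H u + exp (ρ * z * u) * H' u))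
    (fun u hu => ((hF _ (habs u hu).1).comp_const_add z u).sub
      ((((hasDerivAt_id u).const_mul (ρ * z)).exp).mul (hH u (habs u hu).2)))
    (fun u hu => by
      have h1 : (z + u - z) * F' (z + u) + (σ + ρ - ρ * z * (z + u)) * F (z + u) = 1 :=
        hF' _ (habs u hu).1
      have h2 : u * H' u + (σ + ρ - ρ * z ^ 2) * H u = exp (-(ρ * z * u)) :=
        hH' _ (habs u hu).2
      have h3 : exp (ρ * z * u) * exp (-(ρ * z * u)) = 1 := by rw [← exp_add]; simp
      linear_combination h1 - exp (ρ * z * u) * h2 - h3)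
  have hF1 : F (z + (1 - z)) = ∑' m, chainCoeff ρ σ z m := by simp [hFdef]
  have hH1 : H (1 - z) = ∑' n : ℕ, 1 / (σ + ρ + n - ρ * z ^ 2) *
      (-(ρ * z * (1 - z))) ^ n / n.factorial := by
    refine tsum_congr fun n => ?_
    rw [show -(ρ * z * (1 - z)) = -(ρ * z) * (1 - z) by ring, mul_pow,
      show σ + ρ + n - ρ * z ^ 2 = σ + ρ - ρ * z ^ 2 + n by ring]
    ring
  rw [← hF1, ← hH1]
  exact sub_eq_zero.1 hzero

/-- generating function of `κ(σ)`, the number of arrivals and departures in an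
initially empty `M/M/∞` system until an `exp(σ)`-distributed observation period ends.  The sum
over `k ≥ 1` of `z^k ℙ(κ(σ)=k)` is written with `k−1` reindexed to `k`. -/
theorem genFun_kappa (ρ σ z : ℝ) (hρ : 0 < ρ) (hσ : 0 < σ) (hz0 : 0 < z) (hz1 : z < 1) :
    ∑' k : ℕ, z ^ (k + 1) * ∑' m : ℕ, σ / ((m : ℝ) + σ + ρ) * pchain ρ σ k m =
      σ * z * Real.exp (ρ * z * (1 - z)) *
        ∑' n : ℕ, 1 / (σ + ρ + n - ρ * z ^ 2) * (-(ρ * z * (1 - z))) ^ n / n.factorial := by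
  rw [mul_assoc, ← tsum_chainCoeff hρ hσ hz0 hz1]
  simp only [chainCoeff]
  rw [(summable_pow_mul_pchain_div hρ hσ hz0 hz1).tsum_comm, ← tsum_mul_left]
  refine tsum_congr fun k => ?_
  rw [← tsum_mul_left, ← tsum_mul_left]
  exact tsum_congr fun m => by ring
end

section
/- Let ρ > 0, σ > 0 and 0 ≤ z ≤ 1. Then Σ_{k=0}^∞ z^k · Σ_{m=0}^∞ (σ/(m+σ+ρ)) · p_{2k+m}(m) = σ · Σ_{n=0}^∞ ((σ+n)^n · e^{−(σ+n)}/n!) · (1/(σ+ρ+n−ρz)). (The left-hand side is the probability generating function of the number 𝔡(σ) of departures from an initially empty M/M/∞ system during an exp(σ)-distributed observation period, expressed via the path probabilities of the underlying absorbed chain using κ(σ) = 2𝔡(σ)+ν(σ)+1.) -/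
section

open Real Filter Topology Finset MeasureTheory Set

theorem hasSum_pow_div_factorial (x : ℝ) :
    HasSum (fun n : ℕ => x ^ n / n.factorial) (exp x) := by
  rw [Real.exp_eq_exp_ℝ]
  exact NormedSpace.expSeries_div_hasSum_exp x

theorem sum_antidiagonal_abel (σ : ℝ) (N : ℕ) :
    ∑ p ∈ antidiagonal N, (σ + p.1) ^ p.1 / p.1.factorial *
      ((-(σ + p.1)) ^ p.2 / p.2.factorial) = 1 := by
  have h := congrFun (fwdDiff_iter_eq_factorial (R := ℝ) (n := N)) σ
  rw [fwdDiff_iter_eq_sum_shift] at h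
  have hN : (N.factorial : ℝ) ≠ 0 := by positivity
  rw [Finset.Nat.sum_antidiagonal_eq_sum_range_succ_mk, ← mul_right_inj' hN, mul_one]
  refine Eq.trans ?_ h
  rw [Finset.mul_sum]
  refine Finset.sum_congr rfl fun k hk => ?_
  have hkN : k ≤ N := by simpa [Nat.lt_succ_iff] using hk
  have hc : (N.choose k : ℝ) * k.factorial * (N - k).factorial = N.factorial := by
    exact_mod_cast Nat.choose_mul_factorial_mul_factorial hkN
  have h1 : (σ + k) ^ N = (σ + k) ^ k * (σ + k) ^ (N - k) := by
    rw [← pow_add, Nat.add_sub_cancel' hkN]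
  have h2 : (k.factorial : ℝ) ≠ 0 := by positivity
  have h3 : ((N - k).factorial : ℝ) ≠ 0 := by positivity
  simp only [nsmul_eq_mul, mul_one, zsmul_eq_mul, Int.cast_mul, Int.cast_pow, Int.cast_neg,
    Int.cast_one, Int.cast_natCast]
  rw [h1, ← hc, neg_pow (σ + (k : ℝ)) (N - k)]
  field_simp

theorem hasSum_abel_of_abs_lt {σ t : ℝ} (hσ : 0 < σ) (ht : |t| * exp (1 + |t|) < 1) :
    HasSum (fun n : ℕ => (σ + n) ^ n / n.factorial * t ^ n * exp (-((σ + n) * t)))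
      (1 / (1 - t)) := by
  set f : ℕ × ℕ → ℝ := fun p => (σ + p.1) ^ p.1 / p.1.factorial * t ^ p.1 *
    ((-((σ + p.1) * t)) ^ p.2 / p.2.factorial) with hf
  have hnorm : ∀ n j : ℕ, ‖f (n, j)‖ = (σ + n) ^ n / n.factorial * |t| ^ n *
      (((σ + n) * |t|) ^ j / j.factorial) := fun n j => by
    have : 0 < σ + n := by positivity
    simp only [hf, norm_mul, norm_div, norm_pow, norm_neg, Real.norm_eq_abs, abs_of_pos this,
      Nat.abs_cast]
  have hrow : ∀ n : ℕ, HasSum (fun j => ‖f (n, j)‖)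
      ((σ + n) ^ n / n.factorial * |t| ^ n * exp ((σ + n) * |t|)) := fun n => by
    simp only [hnorm]
    exact (hasSum_pow_div_factorial _).mul_left _
  have hsum : Summable f := by
    refine Summable.of_norm ((summable_prod_of_nonneg fun p => norm_nonneg _).2
      ⟨fun n => (hrow n).summable, ?_⟩)
    simp only [(hrow _).tsum_eq]
    refine Summable.of_nonneg_of_le (fun n => by positivity) (fun n => ?_)
      ((summable_geometric_of_lt_one (by positivity) ht).mul_left (exp (σ * (1 + |t|))))
    have h := pow_div_factorial_le_exp (σ + n) (by positivity) n
    calc _ ≤ exp (σ + n) * |t| ^ n * exp ((σ + n) * |t|) := by gcongr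
      _ = _ := by
        rw [mul_pow, ← Real.exp_nat_mul, mul_right_comm, ← Real.exp_add, mul_left_comm,
          ← Real.exp_add, mul_comm]
        congr 2
        ring
  have h1 : HasSum (fun n : ℕ => (σ + n) ^ n / n.factorial * t ^ n * exp (-((σ + n) * t)))
      (∑' p, f p) :=
    hsum.hasSum.prod_fiberwise fun n => (hasSum_pow_div_factorial _).mul_left _
  have h2 : HasSum (fun N : ℕ => t ^ N) (∑' p, f p) := by
    have h := (Finset.HasAntidiagonal.sigmaAntidiagonalEquivProd (A := ℕ)).hasSum_iff.2 hsum.hasSum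
    have h' := h.sigma fun N => (hasSum_fintype _)
    convert! h' using 2 with N
    simp only [Function.comp_apply, Finset.HasAntidiagonal.sigmaAntidiagonalEquivProd_apply]
    rw [Finset.univ_eq_attach, Finset.sum_attach (antidiagonal N) f,
      ← mul_one (t ^ N), ← sum_antidiagonal_abel σ N, Finset.mul_sum]
    refine Finset.sum_congr rfl fun p hp => ?_
    rw [← Finset.HasAntidiagonal.mem_antidiagonal.1 hp]
    simp only [hf, ← neg_mul, mul_pow, pow_add]
    ring
  have ht1 : |t| < 1 := by
    have : (1 : ℝ) ≤ exp (1 + |t|) := Real.one_le_exp (by positivity)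
    nlinarith [abs_nonneg t]
  rwa [h2.unique (hasSum_geometric_of_abs_lt_one ht1), ← one_div] at h1

theorem abs_mul_exp_neg_lt {t : ℝ} (h1 : -(1 / 10) < t) (h2 : t < 1) :
    |t * exp (-t)| < exp (-1) := by
  rw [abs_mul, abs_of_pos (exp_pos _)]
  rcases le_or_gt 0 t with h | h
  · rw [abs_of_nonneg h]
    have h3 := Real.add_one_lt_exp (x := t - 1) (by linarith)
    calc t * exp (-t) < exp (t - 1) * exp (-t) := by gcongr; linarith
      _ = exp (-1) := by rw [← Real.exp_add]; congr 1; ring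
  · have he : exp (-t) * exp 1 ≤ 9 := by
      rw [← Real.exp_add]
      have h4 := Real.exp_one_lt_d9
      calc exp (-t + 1) ≤ exp (1 + 1) := by gcongr; linarith
        _ ≤ 9 := by rw [Real.exp_add]; nlinarith [Real.exp_pos 1]
    rw [Real.exp_neg 1, lt_inv_comm₀ (by have := abs_pos_of_neg h; positivity) (exp_pos _),
      lt_inv_comm₀ (exp_pos _) (by have := abs_pos_of_neg h; positivity), ← one_div,
      lt_div_iff₀ (exp_pos _), abs_of_neg h]
    nlinarith [Real.exp_pos (-t)]

theorem hasSum_abel {σ t : ℝ} (hσ : 0 < σ) (ht0 : 0 ≤ t) (ht1 : t < 1) :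
    HasSum (fun n : ℕ => (σ + n) ^ n / n.factorial * t ^ n * exp (-((σ + n) * t)))
      (1 / (1 - t)) := by
  set c : ℕ → ℝ := fun n => (σ + n) ^ n / n.factorial with hc
  have hterm : ∀ (t : ℝ) (n : ℕ), (σ + n) ^ n / n.factorial * t ^ n * exp (-((σ + n) * t)) =
      exp (-(σ * t)) * (c n * (t * exp (-t)) ^ n) := fun t n => by
    rw [mul_pow, ← Real.exp_nat_mul, show -((σ + n) * t) = -(σ * t) + n * -t by ring,
      Real.exp_add]
    ring
  set p := FormalMultilinearSeries.ofScalars ℝ c with hp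
  have hrad : ENNReal.ofReal (exp (-1)) ≤ p.radius := by
    refine p.le_radius_of_bound (exp σ) fun n => ?_
    rw [FormalMultilinearSeries.ofScalars_norm, Real.coe_toNNReal _ (exp_pos _).le,
      Real.norm_of_nonneg (by positivity), ← Real.exp_nat_mul]
    calc c n * exp (n * -1) ≤ exp (σ + n) * exp (n * -1) := by
          gcongr
          exact pow_div_factorial_le_exp (σ + n) (by positivity) n
      _ = exp σ := by rw [← Real.exp_add]; congr 1; ring
  have hball : HasFPowerSeriesOnBall p.sum p 0 p.radius :=
    p.hasFPowerSeriesOnBall (lt_of_lt_of_le (by simp [exp_pos]) hrad)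
  have hmem : ∀ t ∈ Ioo (-(1 / 10) : ℝ) 1, t * exp (-t) ∈ Metric.eball (0 : ℝ) p.radius := by
    intro t ht
    refine Metric.eball_subset_eball hrad ?_
    rw [Metric.eball_ofReal, mem_ball_zero_iff]
    exact abs_mul_exp_neg_lt ht.1 ht.2
  have hsumc : ∀ t ∈ Ioo (-(1 / 10) : ℝ) 1,
      HasSum (fun n => c n * (t * exp (-t)) ^ n) (p.sum (t * exp (-t))) := fun t ht => by
    have := hball.hasSum (hmem t ht)
    simpa [hp, FormalMultilinearSeries.ofScalars_apply_eq, mul_comm] using this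
  have hL : AnalyticOnNhd ℝ (fun t => exp (-(σ * t)) * p.sum (t * exp (-t)))
      (Ioo (-(1 / 10) : ℝ) 1) := fun t ht => by
    have h1 : AnalyticAt ℝ p.sum (t * exp (-t)) := hball.analyticAt_of_mem (hmem t ht)
    have h2 : AnalyticAt ℝ (fun t : ℝ => t * exp (-t)) t := by fun_prop
    have h3 : AnalyticAt ℝ (fun t : ℝ => exp (-(σ * t))) t := by fun_prop
    exact h3.mul (AnalyticAt.fun_comp (f := fun t : ℝ => t * exp (-t)) h1 h2)
  have hR : AnalyticOnNhd ℝ (fun t => 1 / (1 - t)) (Ioo (-(1 / 10) : ℝ) 1) := fun t ht =>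
    analyticAt_const.div (by fun_prop) (by linarith [ht.2])
  have hsm : ∀ᶠ t : ℝ in 𝓝 0, |t| * exp (1 + |t|) < 1 := by
    have : ContinuousAt (fun t : ℝ => |t| * exp (1 + |t|)) 0 := by fun_prop
    exact this.eventually_lt_const (by simp)
  have hU : ∀ᶠ t : ℝ in 𝓝 0, t ∈ Ioo (-(1 / 10) : ℝ) 1 :=
    Ioo_mem_nhds (by norm_num) (by norm_num)
  have hEq := hL.eqOn_of_preconnected_of_eventuallyEq hR isPreconnected_Ioo (z₀ := 0)
    (by norm_num) (by
      filter_upwards [hsm, hU] with t ht ht'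
      have h := hasSum_abel_of_abs_lt hσ ht
      simp only [hterm] at h
      exact ((hsumc t ht').mul_left _).unique h)
  have ht : t ∈ Ioo (-(1 / 10) : ℝ) 1 := ⟨by linarith, ht1⟩
  simp only [hterm]
  have h := (hsumc t ht).mul_left (exp (-(σ * t)))
  have he : exp (-(σ * t)) * p.sum (t * exp (-t)) = 1 / (1 - t) := hEq ht
  rwa [he] at h

theorem hasSum_setIntegral_of_nonneg {s : Set ℝ} (hs : MeasurableSet s) {F : ℕ → ℝ → ℝ}
    {f : ℝ → ℝ} (hF : ∀ n, Continuous (F n)) (hpos : ∀ n, ∀ t ∈ s, 0 ≤ F n t)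
    (hsum : ∀ t ∈ s, HasSum (fun n => F n t) (f t)) (hf : IntegrableOn f s) :
    HasSum (fun n => ∫ t in s, F n t) (∫ t in s, f t) := by
  refine hasSum_integral_of_dominated_convergence F
    (fun n => (hF n).aestronglyMeasurable) (fun n => ?_) ?_ ?_ ?_
  · exact ae_restrict_of_forall_mem hs fun t ht => (Real.norm_of_nonneg (hpos n t ht)).le
  · exact ae_restrict_of_forall_mem hs fun t ht => (hsum t ht).summable
  · exact (integrableOn_congr_fun (fun t ht => (hsum t ht).tsum_eq) hs).2 hf
  · exact ae_restrict_of_forall_mem hs hsum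

/-- The primitive of `t ↦ 1 - exp (-t)` vanishing at `0`. -/
noncomputable def meanGap (t : ℝ) : ℝ := t - 1 + exp (-t)

theorem continuous_meanGap : Continuous meanGap := by
  unfold meanGap; fun_prop

theorem meanGap_nonneg (t : ℝ) : 0 ≤ meanGap t := by
  have := Real.add_one_le_exp (-t)
  unfold meanGap; linarith

theorem meanGap_zero : meanGap 0 = 0 := by simp [meanGap]

theorem hasDerivAt_meanGap (t : ℝ) : HasDerivAt meanGap (1 - exp (-t)) t := by
  have h := ((hasDerivAt_id t).sub_const 1).add (hasDerivAt_neg t).exp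
  convert! h using 1
  ring

theorem tendsto_meanGap_atTop : Tendsto meanGap atTop atTop := by
  refine tendsto_atTop_mono (f := fun t => t + -1) (fun t => ?_)
    (tendsto_atTop_add_const_right _ _ tendsto_id)
  have := exp_pos (-t)
  unfold meanGap; linarith

theorem one_sub_exp_neg_nonneg {t : ℝ} (ht : 0 ≤ t) : 0 ≤ 1 - exp (-t) := by
  simpa using ht

theorem integral_mul_exp_neg_meanGap {c : ℝ} (hc : 0 < c) :
    ∫ t in Ioi (0 : ℝ), (1 - exp (-t)) * exp (-(c * meanGap t)) = 1 / c := by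
  have hd : ∀ t ∈ Ici (0 : ℝ), HasDerivAt (fun t => -(exp (-(c * meanGap t)) / c))
      ((1 - exp (-t)) * exp (-(c * meanGap t))) t := fun t _ => by
    have h := ((((hasDerivAt_meanGap t).const_mul c).neg).exp.div_const c).neg
    convert! h using 1
    simp only [Pi.neg_apply]
    field_simp
  have hlim : Tendsto (fun t => -(exp (-(c * meanGap t)) / c)) atTop (𝓝 0) := by
    have h := Real.tendsto_exp_neg_atTop_nhds_zero.comp
      (tendsto_meanGap_atTop.const_mul_atTop hc)
    simpa using (h.div_const c).neg
  rw [integral_Ioi_of_hasDerivAt_of_nonneg' hd (fun t ht =>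
    mul_nonneg (one_sub_exp_neg_nonneg (le_of_lt ht)) (exp_pos _).le) hlim]
  simp [meanGap_zero]

theorem integrableOn_exp_neg_mul {σ : ℝ} (hσ : 0 < σ) :
    IntegrableOn (fun t => exp (-(σ * t))) (Ioi 0) := by
  simpa only [neg_mul] using exp_neg_integrableOn_Ioi 0 hσ

theorem integrableOn_of_le_exp_neg {σ : ℝ} (hσ : 0 < σ) {f : ℝ → ℝ} (hf : Continuous f)
    (hpos : ∀ t ∈ Ioi (0 : ℝ), 0 ≤ f t) (hle : ∀ t ∈ Ioi (0 : ℝ), f t ≤ exp (-(σ * t))) :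
    IntegrableOn f (Ioi 0) :=
  (integrableOn_exp_neg_mul hσ).mono' hf.aestronglyMeasurable
    (ae_restrict_of_forall_mem measurableSet_Ioi fun t ht => by
      rw [Real.norm_of_nonneg (hpos t ht)]
      exact hle t ht)

theorem integrableOn_exp_neg_sub_meanGap {σ a : ℝ} (hσ : 0 < σ) (ha : 0 ≤ a) :
    IntegrableOn (fun t => exp (-(σ * t) - a * meanGap t)) (Ioi 0) := by
  have := continuous_meanGap
  refine integrableOn_of_le_exp_neg hσ (by fun_prop) (fun t _ => (exp_pos _).le) fun t _ => ?_
  have := mul_nonneg ha (meanGap_nonneg t)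
  gcongr
  linarith

theorem hasSum_integral_exp_neg_meanGap {σ a : ℝ} (hσ : 0 < σ) (ha : 0 ≤ a) :
    HasSum (fun n : ℕ => (σ + n) ^ n * exp (-(σ + n)) / n.factorial * (1 / (σ + n + a)))
      (∫ t in Ioi (0 : ℝ), exp (-(σ * t) - a * meanGap t)) := by
  have hcont := continuous_meanGap
  have h := hasSum_setIntegral_of_nonneg measurableSet_Ioi
    (F := fun n t => (σ + n) ^ n * exp (-(σ + n)) / n.factorial *
      ((1 - exp (-t)) * exp (-((σ + n + a) * meanGap t))))
    (f := fun t => exp (-(σ * t) - a * meanGap t)) (fun n => by fun_prop)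
    (fun n t ht => by
      have := one_sub_exp_neg_nonneg (le_of_lt ht)
      positivity)
    (fun t ht => ?_) (integrableOn_exp_neg_sub_meanGap hσ ha)
  · convert! h using 2 with n
    rw [integral_const_mul, integral_mul_exp_neg_meanGap (by positivity)]
  · have ht1 : exp (-t) < 1 := by simpa using ht
    have h1 := (hasSum_abel hσ (exp_pos (-t)).le ht1).mul_left
      ((1 - exp (-t)) * exp (-(σ * t) - a * meanGap t))
    rw [mul_one_div, mul_div_cancel_left₀ _ (by linarith)] at h1
    refine h1.congr_fun fun n => ?_
    have : exp (-(σ + n)) * exp (-((σ + n + a) * meanGap t)) =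
        exp (-(σ * t) - a * meanGap t) * (exp (-t) ^ n * exp (-((σ + n) * exp (-t)))) := by
      rw [← Real.exp_nat_mul, ← Real.exp_add, ← Real.exp_add, ← Real.exp_add, meanGap]
      congr 1
      ring
    linear_combination ((σ + n) ^ n / n.factorial * (1 - exp (-t))) * this

/-- The function `t ↦ exp (-σ t) P(D = k) P(N = m)`, where `D` and `N` are the Poisson numbers of
departures by time `t` and of customers present at time `t`. -/
noncomputable def jointWeight (ρ σ : ℝ) (k m : ℕ) (t : ℝ) : ℝ :=
  exp (-((σ + ρ) * t)) * ((ρ * meanGap t) ^ k / k.factorial) *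
    ((ρ * (1 - exp (-t))) ^ m / m.factorial)

theorem continuous_jointWeight (ρ σ : ℝ) (k m : ℕ) : Continuous (jointWeight ρ σ k m) := by
  have := continuous_meanGap
  unfold jointWeight; fun_prop

section Weight

variable {ρ σ t : ℝ}

theorem jointWeight_nonneg (hρ : 0 ≤ ρ) (ht : 0 ≤ t) (k m : ℕ) :
    0 ≤ jointWeight ρ σ k m t := by
  have := one_sub_exp_neg_nonneg ht
  have := meanGap_nonneg t
  unfold jointWeight; positivity

theorem jointWeight_le (hρ : 0 ≤ ρ) (ht : 0 ≤ t) (k m : ℕ) :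
    jointWeight ρ σ k m t ≤ exp (-(σ * t)) := by
  have h1 := mul_nonneg hρ (one_sub_exp_neg_nonneg ht)
  have h2 := mul_nonneg hρ (meanGap_nonneg t)
  calc jointWeight ρ σ k m t
      ≤ exp (-((σ + ρ) * t)) * exp (ρ * meanGap t) * exp (ρ * (1 - exp (-t))) := by
        unfold jointWeight
        gcongr
        · exact pow_div_factorial_le_exp _ h2 k
        · exact pow_div_factorial_le_exp _ h1 m
    _ = exp (-(σ * t)) := by
        rw [← Real.exp_add, ← Real.exp_add, meanGap]
        congr 1
        ring

theorem hasDerivAt_pow_div_factorial {f : ℝ → ℝ} {f' : ℝ} (hf : HasDerivAt f f' t) (k : ℕ) :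
    HasDerivAt (fun t => f t ^ k / k.factorial)
      ((if k = 0 then 0 else f t ^ (k - 1) / (k - 1).factorial) * f') t := by
  refine ((hf.pow k).div_const (k.factorial : ℝ)).congr_deriv ?_
  cases k with
  | zero => simp
  | succ k =>
    rw [Nat.factorial_succ]
    push_cast
    field_simp

theorem hasDerivAt_jointWeight (k m : ℕ) :
    HasDerivAt (jointWeight ρ σ k m)
      (-((m + σ + ρ) * jointWeight ρ σ k m t) +
        ((if m = 0 then 0 else ρ * jointWeight ρ σ k (m - 1) t) +
          (if k = 0 then 0 else (m + 1) * jointWeight ρ σ (k - 1) (m + 1) t))) t := by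
  have h1 : HasDerivAt (fun t => exp (-((σ + ρ) * t)))
      (exp (-((σ + ρ) * t)) * (-((σ + ρ) * 1))) t :=
    (((hasDerivAt_id t).const_mul (σ + ρ)).neg).exp
  have h2 := hasDerivAt_pow_div_factorial ((hasDerivAt_meanGap t).const_mul ρ) k
  have h3 := hasDerivAt_pow_div_factorial
    ((((hasDerivAt_neg t).exp).const_sub 1).const_mul ρ) m
  convert! (h1.mul h2).mul h3 using 1
  unfold jointWeight
  have hf : ∀ n : ℕ, (n.factorial : ℝ) ≠ 0 := fun n => by positivity
  rcases k with _ | k <;> rcases m with _ | m <;>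
    simp only [Nat.add_sub_cancel, Nat.succ_ne_zero, if_false, if_true, Pi.mul_apply,
      Nat.factorial_succ, Nat.factorial_zero, pow_succ, pow_zero, zero_add] <;>
    push_cast <;> field_simp <;> ring

theorem integrableOn_jointWeight (hρ : 0 ≤ ρ) (hσ : 0 < σ) (k m : ℕ) :
    IntegrableOn (jointWeight ρ σ k m) (Ioi 0) :=
  integrableOn_of_le_exp_neg hσ (continuous_jointWeight ρ σ k m)
    (fun _ ht => jointWeight_nonneg hρ (le_of_lt ht) k m)
    (fun _ ht => jointWeight_le hρ (le_of_lt ht) k m)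

theorem tendsto_jointWeight (hρ : 0 ≤ ρ) (hσ : 0 < σ) (k m : ℕ) :
    Tendsto (jointWeight ρ σ k m) atTop (𝓝 0) := by
  have h := Real.tendsto_exp_neg_atTop_nhds_zero.comp (tendsto_id.const_mul_atTop hσ)
  refine tendsto_of_tendsto_of_tendsto_of_le_of_le' tendsto_const_nhds h ?_ ?_
  · filter_upwards [eventually_ge_atTop 0] with t ht using jointWeight_nonneg hρ ht k m
  · filter_upwards [eventually_ge_atTop 0] with t ht using jointWeight_le hρ ht k m

theorem integral_jointWeight_recursion (hρ : 0 ≤ ρ) (hσ : 0 < σ) (k m : ℕ) :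
    (m + σ + ρ) * ∫ t in Ioi 0, jointWeight ρ σ k m t =
      0 ^ k * 0 ^ m + ((if m = 0 then 0 else ρ * ∫ t in Ioi 0, jointWeight ρ σ k (m - 1) t) +
        (if k = 0 then 0 else (m + 1) * ∫ t in Ioi 0, jointWeight ρ σ (k - 1) (m + 1) t)) := by
  have hint := integrableOn_jointWeight (σ := σ) hρ hσ
  have i1 := ((hint k m).const_mul (m + σ + ρ)).neg
  have i2 : IntegrableOn (fun t => if m = 0 then 0 else ρ * jointWeight ρ σ k (m - 1) t)
      (Ioi 0) := by
    split_ifs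
    · exact integrableOn_zero
    · exact (hint _ _).const_mul _
  have i3 : IntegrableOn
      (fun t => if k = 0 then 0 else (m + 1) * jointWeight ρ σ (k - 1) (m + 1) t)
      (Ioi 0) := by
    split_ifs
    · exact integrableOn_zero
    · exact (hint _ _).const_mul _
  have h := integral_Ioi_of_hasDerivAt_of_tendsto'
    (fun t _ => hasDerivAt_jointWeight (ρ := ρ) (σ := σ) (t := t) k m)
    (i1.add (i2.add i3)) (tendsto_jointWeight hρ hσ k m)
  have h0 : jointWeight ρ σ k m 0 = 0 ^ k * 0 ^ m := by
    rcases k with _ | k <;> rcases m with _ | m <;> simp [jointWeight, meanGap_zero]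
  have e1 := (integral_add i1 (i2.add i3)).symm.trans h
  rw [integral_add' i2 i3, integral_neg', integral_const_mul, h0] at e1
  have e2 : (∫ t in Ioi (0 : ℝ), if m = 0 then 0 else ρ * jointWeight ρ σ k (m - 1) t) =
      if m = 0 then 0 else ρ * ∫ t in Ioi 0, jointWeight ρ σ k (m - 1) t := by
    split_ifs <;> simp [integral_const_mul]
  have e3 : (∫ t in Ioi (0 : ℝ),
        if k = 0 then 0 else ((m : ℝ) + 1) * jointWeight ρ σ (k - 1) (m + 1) t) =
      if k = 0 then 0 else (m + 1) * ∫ t in Ioi 0, jointWeight ρ σ (k - 1) (m + 1) t := by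
    split_ifs <;> simp [integral_const_mul]
  rw [e2, e3] at e1
  linarith

end Weight

theorem pchain_eq_zero_of_lt (ρ σ : ℝ) {k m : ℕ} (h : k < m) : pchain ρ σ k m = 0 := by
  induction k generalizing m with
  | zero => simp [pchain, h.ne']
  | succ k ih => simp [pchain, ih (show k < m - 1 by omega), ih (show k < m + 1 by omega)]

theorem pchain_eq_integral {ρ σ : ℝ} (hρ : 0 ≤ ρ) (hσ : 0 < σ) (N : ℕ) :
    ∀ k m : ℕ, 2 * k + m = N →
      pchain ρ σ N m = (m + σ + ρ) * ∫ t in Ioi 0, jointWeight ρ σ k m t := by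
  induction N with
  | zero =>
    intro k m h
    obtain ⟨rfl, rfl⟩ : k = 0 ∧ m = 0 := by omega
    rw [integral_jointWeight_recursion hρ hσ]
    simp [pchain]
  | succ N ih =>
    intro k m h
    rw [integral_jointWeight_recursion hρ hσ, pchain]
    have h0 : (0 : ℝ) ^ k * 0 ^ m = 0 := by
      rcases k with _ | k <;> rcases m with _ | m <;> simp at h ⊢
    rw [h0, zero_add]
    congr 1
    · rcases m with _ | m
      · simp
      · have hne : (m : ℝ) + σ + ρ ≠ 0 := by positivity
        simp only [Nat.add_sub_cancel, Nat.succ_ne_zero, if_false, Nat.le_add_left, if_true]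
        rw [ih k m (by omega)]
        push_cast
        rw [add_sub_cancel_right]
        field_simp
    · rcases k with _ | k
      · simp [pchain_eq_zero_of_lt ρ σ (show N < m + 1 by omega)]
      · have hne : (m : ℝ) + 1 + σ + ρ ≠ 0 := by positivity
        simp only [Nat.add_sub_cancel, Nat.succ_ne_zero, if_false]
        rw [ih k (m + 1) (by omega)]
        push_cast
        field_simp

theorem hasSum_integral_jointWeight {ρ σ : ℝ} (hρ : 0 ≤ ρ) (hσ : 0 < σ) (k : ℕ) :
    HasSum (fun m => ∫ t in Ioi 0, jointWeight ρ σ k m t)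
      (∫ t in Ioi 0, exp (-(σ * t) - ρ * meanGap t) * ((ρ * meanGap t) ^ k / k.factorial)) := by
  have hcont := continuous_meanGap
  refine hasSum_setIntegral_of_nonneg measurableSet_Ioi (continuous_jointWeight ρ σ k)
    (fun m t ht => jointWeight_nonneg hρ (le_of_lt ht) k m) (fun t _ => ?_) ?_
  · convert! (hasSum_pow_div_factorial (ρ * (1 - exp (-t)))).mul_left
      (exp (-((σ + ρ) * t)) * ((ρ * meanGap t) ^ k / k.factorial)) using 1
    rw [mul_right_comm, ← Real.exp_add, meanGap]
    congr 2
    ring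
  · refine integrableOn_of_le_exp_neg hσ (by fun_prop) (fun t _ => ?_) fun t _ => ?_
    · have := meanGap_nonneg t
      positivity
    · have h := pow_div_factorial_le_exp _ (mul_nonneg hρ (meanGap_nonneg t)) k
      calc _ ≤ exp (-(σ * t) - ρ * meanGap t) * exp (ρ * meanGap t) := by gcongr
        _ = _ := by rw [← Real.exp_add, sub_add_cancel]

theorem hasSum_pow_mul_integral {ρ σ z : ℝ} (hρ : 0 ≤ ρ) (hσ : 0 < σ) (hz0 : 0 ≤ z)
    (hz1 : z ≤ 1) :
    HasSum (fun k : ℕ => z ^ k * ∫ t in Ioi 0,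
        exp (-(σ * t) - ρ * meanGap t) * ((ρ * meanGap t) ^ k / k.factorial))
      (∫ t in Ioi 0, exp (-(σ * t) - ρ * (1 - z) * meanGap t)) := by
  have hcont := continuous_meanGap
  simp only [← integral_const_mul]
  refine hasSum_setIntegral_of_nonneg measurableSet_Ioi (fun k => by fun_prop)
    (fun k t _ => ?_) (fun t _ => ?_)
    (integrableOn_exp_neg_sub_meanGap hσ (mul_nonneg hρ (sub_nonneg.2 hz1)))
  · have := meanGap_nonneg t
    positivity
  · convert! (hasSum_pow_div_factorial (z * (ρ * meanGap t))).mul_left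
      (exp (-(σ * t) - ρ * meanGap t)) using 1
    · ext k
      rw [mul_pow]
      ring
    · rw [← Real.exp_add]
      congr 1
      ring

end

/-- generating function of the number `𝔡(σ)` of departures from an initially empty
`M/M/∞` system during an `exp(σ)`-distributed observation period, expressed via the path
probabilities of the underlying absorbed chain using `κ(σ) = 2𝔡(σ)+ν(σ)+1`. -/
theorem genFun_departures (ρ σ z : ℝ) (hρ : 0 < ρ) (hσ : 0 < σ) (hz0 : 0 ≤ z) (hz1 : z ≤ 1) :
    ∑' k : ℕ, z ^ k * ∑' m : ℕ, σ / ((m : ℝ) + σ + ρ) * pchain ρ σ (2 * k + m) m =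
      σ * ∑' n : ℕ,
        ((σ + n) ^ n * Real.exp (-(σ + n)) / n.factorial) * (1 / (σ + ρ + n - ρ * z)) := by
  have hterm : ∀ k m : ℕ, σ / ((m : ℝ) + σ + ρ) * pchain ρ σ (2 * k + m) m =
      σ * ∫ t in Set.Ioi 0, jointWeight ρ σ k m t := fun k m => by
    have : (m : ℝ) + σ + ρ ≠ 0 := by positivity
    rw [pchain_eq_integral hρ.le hσ _ k m rfl]
    field_simp
  have hden : ∀ n : ℕ, σ + ρ + n - ρ * z = σ + n + ρ * (1 - z) := fun n => by ring
  simp only [hterm, hden, tsum_mul_left, (hasSum_integral_jointWeight hρ.le hσ _).tsum_eq,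
    mul_left_comm _ σ]
  rw [(hasSum_pow_mul_integral hρ.le hσ hz0 hz1).tsum_eq,
    (hasSum_integral_exp_neg_meanGap hσ (mul_nonneg hρ.le (sub_nonneg.2 hz1))).tsum_eq]
end

section
/- Let σ > 0 and let X be a real number such that X ≠ σ + n for every n ∈ ℕ. Then Σ_{n=0}^∞ ((σ+n)^n · e^{−(σ+n)}/n!) · (1/(σ+n−X)) = (1/(σ−X)) · Φ(1, σ−X+1; −X). (This is the partial-fraction/residue expansion of the Kummer function used to pass between the two forms of the generating function of the number of departures.) -/
/-- The Kummer confluent hypergeometric function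
`Φ(α,β;z) = Σ_{n=0}^∞ ((α)_n/(β)_n) · z^n/n!`. -/
noncomputable def kummerPhi (α β z : ℝ) : ℝ :=
  ∑' n : ℕ, ((ascPochhammer ℝ n).eval α / (ascPochhammer ℝ n).eval β) * z ^ n / n.factorial

open Filter Topology

/-- The coefficients of Abel's series `∑ (σ + n)^(n-1) / n! * w^n`. -/
noncomputable def abelCoeff (σ : ℝ) (n : ℕ) : ℝ := (σ + n) ^ n / (σ + n) / n.factorial

theorem abelCoeff_pos {σ : ℝ} (hσ : 0 < σ) (n : ℕ) : 0 < abelCoeff σ n := by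
  unfold abelCoeff; positivity

theorem abelCoeff_le {σ : ℝ} (hσ : 0 < σ) (n : ℕ) :
    abelCoeff σ n ≤ Real.exp σ / σ * Real.exp 1 ^ n := by
  have h := Real.pow_div_factorial_le_exp (σ + n) (by positivity) n
  calc abelCoeff σ n = (σ + n) ^ n / n.factorial / (σ + n) := by unfold abelCoeff; ring
    _ ≤ Real.exp (σ + n) / σ := by gcongr; simp
    _ = _ := by rw [Real.exp_add, ← Real.exp_nat_mul, mul_one]; ring

theorem summable_abelCoeff_mul_pow {σ r : ℝ} (hσ : 0 < σ) (hr : 0 ≤ r)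
    (hr1 : Real.exp 1 * r < 1) : Summable fun n => abelCoeff σ n * r ^ n := by
  refine Summable.of_nonneg_of_le (fun n => mul_nonneg (abelCoeff_pos hσ n).le (by positivity))
    (fun n => ?_) ((summable_geometric_of_lt_one (by positivity) hr1).mul_left (Real.exp σ / σ))
  rw [mul_pow, ← mul_assoc]
  exact mul_le_mul_of_nonneg_right (abelCoeff_le hσ n) (by positivity)

theorem sum_antidiagonal_neg_one_pow_mul_pow (σ : ℝ) (m : ℕ) :
    ∑ p ∈ Finset.HasAntidiagonal.antidiagonal (m + 1), (-1) ^ p.2 * (σ + p.1) ^ m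
      / (p.1.factorial * p.2.factorial) = 0 := by
  have h := congrFun (fwdDiff_iter_pow_eq_zero_of_lt (R := ℝ) (Nat.lt_succ_self m)) σ
  rw [fwdDiff_iter_eq_sum_shift] at h
  rw [Finset.Nat.sum_antidiagonal_eq_sum_range_succ_mk]
  have : ((m + 1).factorial : ℝ) ≠ 0 := by positivity
  refine (mul_eq_zero_iff_left this).1 ?_
  rw [Finset.mul_sum]
  simp only [Nat.succ_eq_add_one, Pi.zero_apply] at h
  refine Eq.trans (Finset.sum_congr rfl fun k hk => ?_) h
  have hk : k ≤ m + 1 := Nat.lt_succ_iff.1 (Finset.mem_range.1 hk)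
  rw [zsmul_eq_mul]
  push_cast
  rw [Nat.cast_choose ℝ hk]
  simp
  ring

theorem abel_double_series_summable {σ t : ℝ} (hσ : 0 < σ)
    (ht : Real.exp 1 * (|t| * Real.exp |t|) < 1) :
    Summable fun p : ℕ × ℕ =>
      abelCoeff σ p.1 * t ^ p.1 * ((-((σ + p.1) * t)) ^ p.2 / p.2.factorial) := by
  refine Summable.of_norm ?_
  have key : ∀ n : ℕ, HasSum (fun k : ℕ => ‖abelCoeff σ n * t ^ n *
      ((-((σ + n) * t)) ^ k / k.factorial)‖)
      (Real.exp (σ * |t|) * (abelCoeff σ n * (|t| * Real.exp |t|) ^ n)) := by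
    intro n
    have h := (NormedSpace.expSeries_div_hasSum_exp ((σ + n) * |t|)).mul_left
      (abelCoeff σ n * |t| ^ n)
    rw [← Real.exp_eq_exp_ℝ] at h
    convert! h using 1
    · funext k
      rw [norm_mul, norm_mul, norm_div, norm_pow, norm_pow, norm_neg, norm_mul]
      simp only [Real.norm_eq_abs]
      rw [abs_of_pos (abelCoeff_pos hσ n), abs_of_pos (by positivity : 0 < σ + n)]
      simp
    · rw [add_mul, Real.exp_add, mul_pow, ← Real.exp_nat_mul]; ring
  refine (summable_prod_of_nonneg fun _ => norm_nonneg _).2 ⟨fun n => (key n).summable, ?_⟩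
  simp only [fun n => (key n).tsum_eq]
  exact (summable_abelCoeff_mul_pow hσ (by positivity) ht).mul_left _

theorem tsum_abel_of_small {σ t : ℝ} (hσ : 0 < σ)
    (ht : Real.exp 1 * (|t| * Real.exp |t|) < 1) :
    ∑' n, abelCoeff σ n * (t * Real.exp (-t)) ^ n = Real.exp (σ * t) / σ := by
  have hF := abel_double_series_summable hσ ht
  have h1 := hF.hasSum.prod_fiberwise (g := fun n : ℕ => Real.exp (-(σ * t)) *
    (abelCoeff σ n * (t * Real.exp (-t)) ^ n)) fun n => by
      have h := (NormedSpace.expSeries_div_hasSum_exp (-((σ + n) * t))).mul_left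
        (abelCoeff σ n * t ^ n)
      rw [← Real.exp_eq_exp_ℝ] at h
      convert! h using 1
      rw [add_mul, neg_add, Real.exp_add, mul_pow, ← Real.exp_nat_mul]; ring_nf
  have h2 := (Finset.HasAntidiagonal.sigmaAntidiagonalEquivProd.hasSum_iff.2 hF.hasSum).sigma
    (g := fun m : ℕ => if m = 0 then 1 / σ else 0) fun m => by
      convert! hasSum_fintype _
      simp only [Function.comp, Finset.HasAntidiagonal.sigmaAntidiagonalEquivProd_apply]
      rw [Finset.sum_coe_sort (Finset.HasAntidiagonal.antidiagonal m) fun p : ℕ × ℕ =>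
        abelCoeff σ p.1 * t ^ p.1 * ((-((σ + p.1) * t)) ^ p.2 / p.2.factorial)]
      rcases m with _ | m
      · simp [abelCoeff]
      · rw [if_neg (by simp), ← mul_zero (t ^ (m + 1)),
          ← sum_antidiagonal_neg_one_pow_mul_pow σ m, Finset.mul_sum]
        refine Finset.sum_congr rfl fun p hp => ?_
        have hp : p.1 + p.2 = m + 1 := Finset.HasAntidiagonal.mem_antidiagonal.1 hp
        have hs : σ + p.1 ≠ 0 := by positivity
        have hpow : (σ + p.1) ^ p.1 * (σ + p.1) ^ p.2 = (σ + p.1) ^ m * (σ + p.1) := by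
          rw [← pow_add, hp, pow_succ]
        rw [abelCoeff, neg_pow (_ * t), mul_pow, ← hp, pow_add]
        field_simp
        linear_combination -(t ^ p.1 * t ^ p.2) * hpow
  have h3 := h1.tsum_eq.trans (h2.unique (hasSum_ite_eq 0 (1 / σ)))
  rw [tsum_mul_left, Real.exp_neg] at h3
  field_simp at h3 ⊢
  linarith

theorem mul_exp_neg_lt {t : ℝ} (ht : t < 1) : Real.exp 1 * (t * Real.exp (-t)) < 1 := by
  have h := Real.add_one_lt_exp (sub_ne_zero.2 ht.ne)
  rw [show t - 1 = -(1 + -t) by ring, Real.exp_neg, Real.exp_add] at h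
  have := mul_lt_mul_of_pos_right h (by positivity : 0 < Real.exp 1 * Real.exp (-t))
  rw [inv_mul_cancel₀ (by positivity)] at this
  linarith

theorem tsum_abel {σ t : ℝ} (hσ : 0 < σ) (ht0 : 0 ≤ t) (ht : t < 1) :
    ∑' n, abelCoeff σ n * (t * Real.exp (-t)) ^ n = Real.exp (σ * t) / σ := by
  set p := FormalMultilinearSeries.ofScalars ℝ (abelCoeff σ)
  have hrad : ∀ r : NNReal, Real.exp 1 * r < 1 → (r : ENNReal) ≤ p.radius := fun r hr =>
    p.le_radius_of_summable_norm (by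
      simpa [p, FormalMultilinearSeries.ofScalars_norm, abs_of_pos (abelCoeff_pos hσ _)]
        using summable_abelCoeff_mul_pow hσ r.2 hr)
  have hsum : ∀ x, p.sum x = ∑' n, abelCoeff σ n * x ^ n := fun x => by
    simpa using! FormalMultilinearSeries.ofScalars_sum_eq (abelCoeff σ) x
  have han : ∀ w : ℝ, Real.exp 1 * |w| < 1 → AnalyticAt ℝ p.sum w := fun w hw => by
    have hlim : ContinuousAt (fun r : ℝ => Real.exp 1 * r) |w| := by fun_prop
    obtain ⟨r, hr, hwr⟩ := ((hlim.eventually_lt_const hw).filter_mono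
      nhdsWithin_le_nhds |>.and (self_mem_nhdsWithin (s := Set.Ioi |w|))).exists
    have hr0 : 0 < r := (abs_nonneg w).trans_lt hwr
    have hle := hrad ⟨r, hr0.le⟩ hr
    have hpos : 0 < p.radius := lt_of_lt_of_le (ENNReal.coe_pos.2 (show (0 : NNReal) < ⟨r, hr0.le⟩ from hr0)) hle
    refine (p.hasFPowerSeriesOnBall hpos).analyticAt_of_mem (lt_of_lt_of_le ?_ hle)
    rw [edist_zero_right, enorm_eq_nnnorm]
    exact ENNReal.coe_lt_coe.2 (show ‖w‖₊ < ⟨r, hr0.le⟩ from hwr)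
  have hδ : ∀ᶠ s : ℝ in 𝓝 0, Real.exp 1 * (|s| * Real.exp |s|) < 1 := by
    have hc : ContinuousAt (fun s : ℝ => Real.exp 1 * (|s| * Real.exp |s|)) 0 := by fun_prop
    exact hc.eventually_lt_const (by simp)
  obtain ⟨δ, hδ0, hball⟩ := Metric.eventually_nhds_iff.1 hδ
  have hU : ∀ s ∈ Set.Ioo (-δ) 1, Real.exp 1 * |s * Real.exp (-s)| < 1 := fun s hs => by
    rcases le_or_gt 0 s with h | h
    · rw [abs_of_nonneg (by positivity)]
      exact mul_exp_neg_lt hs.2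
    · have := @hball s (by rw [dist_zero_right, Real.norm_eq_abs, abs_of_neg h]; linarith [hs.1])
      rwa [abs_mul, abs_of_pos (Real.exp_pos _), ← abs_of_neg h]
  have heq := AnalyticOnNhd.eqOn_of_preconnected_of_eventuallyEq (𝕜 := ℝ)
    (f := fun s => p.sum (s * Real.exp (-s))) (g := fun s => Real.exp (σ * s) / σ)
    (U := Set.Ioo (-δ) 1) (z₀ := 0)
    (fun s hs => (han _ (hU s hs)).fun_comp (f := fun s => s * Real.exp (-s)) (by fun_prop))
    (fun s _ => by fun_prop (disch := exact hσ.ne'))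
    isPreconnected_Ioo ⟨by linarith, one_pos⟩
    (hδ.mono fun s hs => (hsum _).trans (tsum_abel_of_small hσ hs))
  exact (hsum _).symm.trans (heq ⟨by linarith, ht⟩)

/-- Abel's series at the boundary point `w = 1/e` of its disc of convergence. -/
theorem hasSum_abelCoeff_exp {σ : ℝ} (hσ : 0 < σ) :
    HasSum (fun n : ℕ => abelCoeff σ n * Real.exp (-(σ + n))) (1 / σ) := by
  have hnn : ∀ n, 0 ≤ abelCoeff σ n * Real.exp (-1) ^ n := fun n =>
    mul_nonneg (abelCoeff_pos hσ n).le (by positivity)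
  have hsm : ∀ t : ℝ, 0 ≤ t → t < 1 →
      Summable fun n => abelCoeff σ n * (t * Real.exp (-t)) ^ n := fun t h0 h1 =>
    summable_abelCoeff_mul_pow hσ (by positivity) (mul_exp_neg_lt h1)
  have hev : ∀ᶠ t : ℝ in 𝓝[<] 1, 0 ≤ t ∧ t < 1 :=
    Filter.mem_of_superset (Ioo_mem_nhdsLT one_pos) fun t h => ⟨h.1.le, h.2⟩
  have hlim : Tendsto (fun t : ℝ => Real.exp (σ * t) / σ) (𝓝[<] 1) (𝓝 (Real.exp σ / σ)) := by
    have : ContinuousAt (fun t : ℝ => Real.exp (σ * t) / σ) 1 := by fun_prop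
    simpa using this.tendsto.mono_left nhdsWithin_le_nhds
  have hfin : ∀ s : Finset ℕ, ∑ n ∈ s, abelCoeff σ n * Real.exp (-1) ^ n ≤ Real.exp σ / σ := by
    intro s
    have hc : ContinuousAt (fun t : ℝ => ∑ n ∈ s, abelCoeff σ n * (t * Real.exp (-t)) ^ n) 1 := by
      fun_prop
    have hc' := hc.tendsto.mono_left (nhdsWithin_le_nhds (s := Set.Iio 1))
    rw [one_mul] at hc'
    refine le_of_tendsto_of_tendsto hc' hlim (hev.mono fun t ht => ?_)
    exact ((hsm t ht.1 ht.2).sum_le_tsum s fun n _ =>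
      mul_nonneg (abelCoeff_pos hσ n).le (pow_nonneg (mul_nonneg ht.1 (by positivity)) n)).trans
      (tsum_abel hσ ht.1 ht.2).le
  have hsum := summable_of_sum_le hnn hfin
  have hge : Real.exp σ / σ ≤ ∑' n, abelCoeff σ n * Real.exp (-1) ^ n := by
    refine le_of_tendsto hlim (hev.mono fun t ht => ?_)
    rw [← tsum_abel hσ ht.1 ht.2]
    refine (hsm t ht.1 ht.2).tsum_le_tsum (fun n => ?_) hsum
    refine mul_le_mul_of_nonneg_left (pow_le_pow_left₀ (mul_nonneg ht.1 (by positivity)) ?_ n)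
      (abelCoeff_pos hσ n).le
    rw [Real.exp_neg 1, ← one_div, le_div_iff₀' (by positivity)]
    exact (mul_exp_neg_lt ht.2).le
  have h := hsum.hasSum.mul_left (Real.exp (-σ))
  rw [le_antisymm (hsum.tsum_le_of_sum_le hfin) hge] at h
  convert! h using 1
  · funext n
    rw [neg_add, Real.exp_add, ← Real.exp_nat_mul]; ring_nf
  · rw [Real.exp_neg]; field_simp

/-- The general term of the residue expansion. -/
noncomputable def residueTerm (σ X : ℝ) (n : ℕ) : ℝ :=
  (σ + n) ^ n * Real.exp (-(σ + n)) / n.factorial * (1 / (σ + n - X))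

theorem norm_residueTerm_le {σ X : ℝ} {n : ℕ} (hσ : 0 < σ) (h : 2 * |X| ≤ σ + n) :
    ‖residueTerm σ X n‖ ≤ 2 * (abelCoeff σ n * Real.exp (-(σ + n))) := by
  have hpos : 0 < σ + n := by positivity
  have hX := le_abs_self X
  have h1 : 1 / (σ + n - X) ≤ 2 / (σ + n) := by
    rw [div_le_div_iff₀ (by linarith) hpos]; linarith
  have h2 : 0 ≤ 1 / (σ + n - X) := one_div_nonneg.2 (by linarith)
  rw [Real.norm_eq_abs, residueTerm, abs_of_nonneg (by positivity)]
  calc _ ≤ (σ + n) ^ n * Real.exp (-(σ + n)) / n.factorial * (2 / (σ + n)) := by gcongr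
    _ = _ := by unfold abelCoeff; ring

theorem summable_residueTerm {σ : ℝ} (X : ℝ) (hσ : 0 < σ) : Summable (residueTerm σ X) := by
  refine Summable.of_norm_bounded_eventually_nat ((hasSum_abelCoeff_exp hσ).summable.mul_left 2) ?_
  filter_upwards [eventually_ge_atTop ⌈2 * |X|⌉₊] with n hn
  exact norm_residueTerm_le hσ (by linarith [Nat.le_of_ceil_le hn])

theorem norm_tsum_residueTerm_le {σ X : ℝ} (hσ : 0 < σ) (h : 2 * |X| ≤ σ) :
    ‖∑' n, residueTerm σ X n‖ ≤ 2 * (1 / σ) :=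
  tsum_of_norm_bounded ((hasSum_abelCoeff_exp hσ).mul_left 2) fun n =>
    norm_residueTerm_le hσ (h.trans (by simp))

theorem tsum_residueTerm_recurrence {σ X : ℝ} (hσ : 0 < σ) (hX : ∀ n : ℕ, X ≠ σ + n) :
    (σ - X) * ∑' n, residueTerm σ X n = 1 - X * ∑' n, residueTerm (σ + 1) X n := by
  have hA := (hasSum_abelCoeff_exp hσ).mul_left σ
  rw [mul_one_div_cancel hσ.ne'] at hA
  have hF := (summable_residueTerm X hσ).hasSum.mul_left (σ - X)
  have hshift := hA.sub hF
  have hG := (summable_residueTerm X (by positivity : 0 < σ + 1)).hasSum.mul_left X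
  have hne : ∀ n : ℕ, σ + n - X ≠ 0 := fun n => sub_ne_zero.2 (hX n).symm
  have h0 : σ * (abelCoeff σ 0 * Real.exp (-(σ + (0 : ℕ)))) - (σ - X) * residueTerm σ X 0 = 0 := by
    have := hne 0
    simp only [abelCoeff, residueTerm, Nat.cast_zero, add_zero] at this ⊢
    field_simp
    simp
  have hs := (hasSum_nat_add_iff' 1).2 hshift
  rw [Finset.sum_range_one, h0, sub_zero] at hs
  have := hs.unique (hG.congr_fun ?_)
  · linarith
  · intro n
    have h1 := hne (n + 1)
    have h2 : σ + ((n + 1 : ℕ) : ℝ) ≠ 0 := by positivity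
    have h3 : σ + 1 + (n : ℝ) = σ + ((n + 1 : ℕ) : ℝ) := by push_cast; ring
    simp only [abelCoeff, residueTerm]
    rw [h3, Nat.factorial_succ, pow_succ]
    set y := σ + ((n + 1 : ℕ) : ℝ) with hy
    have hn : (n : ℝ) + 1 ≠ 0 := by positivity
    have hy' : σ = y - (n + 1) := by rw [hy]; push_cast; ring
    push_cast
    field_simp
    rw [hy']
    ring

theorem ascPochhammer_eval_ne_zero {s : ℝ} (hs : ∀ n : ℕ, s + n ≠ 0) (n : ℕ) :
    (ascPochhammer ℝ n).eval s ≠ 0 := by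
  induction n with
  | zero => simp
  | succ n ih => rw [ascPochhammer_succ_eval]; exact mul_ne_zero ih (hs n)

theorem summable_pow_div_ascPochhammer {s : ℝ} (hs : ∀ n : ℕ, s + n ≠ 0) (z : ℝ) :
    Summable fun n : ℕ => z ^ n / (ascPochhammer ℝ (n + 1)).eval s := by
  refine summable_of_ratio_norm_eventually_le (r := 1 / 2) (by norm_num) ?_
  filter_upwards [eventually_ge_atTop ⌈2 * |z| - s⌉₊] with n hn
  have hn : 2 * |z| ≤ s + (n + 1 : ℕ) := by push_cast; linarith [Nat.le_of_ceil_le hn]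
  have hne := hs (n + 1)
  have hpos : 0 < s + (n + 1 : ℕ) := lt_of_le_of_ne (by linarith [abs_nonneg z]) hne.symm
  rw [ascPochhammer_succ_eval, pow_succ, mul_div_mul_comm, norm_mul, mul_comm]
  refine mul_le_mul_of_nonneg_right ?_ (norm_nonneg _)
  rw [norm_div, Real.norm_eq_abs, Real.norm_eq_abs, abs_of_pos hpos, div_le_iff₀ hpos]
  linarith

theorem tsum_residueTerm_eq_sum_add {σ X : ℝ} (hσ : 0 < σ) (hX : ∀ n : ℕ, X ≠ σ + n) (N : ℕ) :
    ∑' n, residueTerm σ X n =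
      ∑ k ∈ Finset.range N, (-X) ^ k / (ascPochhammer ℝ (k + 1)).eval (σ - X) +
        (-X) ^ N / (ascPochhammer ℝ N).eval (σ - X) * ∑' n, residueTerm (σ + N) X n := by
  have hs : ∀ n : ℕ, σ - X + n ≠ 0 := fun n h => hX n (by linarith)
  induction N with
  | zero => simp
  | succ N ih =>
    have hrec := tsum_residueTerm_recurrence (σ := σ + N) (X := X) (by positivity)
      fun n h => hX (N + n) (by rw [h]; push_cast; ring)
    have h1 := ascPochhammer_eval_ne_zero hs N
    have h2 := hs N
    rw [ih, Finset.sum_range_succ, ascPochhammer_succ_eval, pow_succ, add_assoc, Nat.cast_succ,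
      ← add_assoc σ]
    congr 1
    field_simp
    linear_combination (-X) ^ N * hrec

theorem one_div_mul_kummerPhi_one (s z : ℝ) :
    1 / s * kummerPhi 1 (s + 1) z =
      ∑' n : ℕ, z ^ n / (ascPochhammer ℝ (n + 1)).eval s := by
  rw [kummerPhi, ← tsum_mul_left]
  refine tsum_congr fun n => ?_
  have h : (n.factorial : ℝ) ≠ 0 := by positivity
  rw [ascPochhammer_eval_one, ascPochhammer_succ_left, Polynomial.eval_mul, Polynomial.eval_comp]
  simp only [Polynomial.eval_X, Polynomial.eval_add, Polynomial.eval_one]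
  rw [mul_div_right_comm, div_right_comm, div_self h]
  ring

theorem tsum_residueTerm {σ X : ℝ} (hσ : 0 < σ) (hX : ∀ n : ℕ, X ≠ σ + n) :
    ∑' n, residueTerm σ X n =
      ∑' n : ℕ, (-X) ^ n / (ascPochhammer ℝ (n + 1)).eval (σ - X) := by
  have hs : ∀ n : ℕ, σ - X + n ≠ 0 := fun n h => hX n (by linarith)
  have hT := summable_pow_div_ascPochhammer hs (-X)
  refine tendsto_nhds_unique ?_ hT.hasSum.tendsto_sum_nat
  refine Tendsto.congr (f₁ := fun N : ℕ => ∑' n, residueTerm σ X n -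
    (-X) ^ N / (ascPochhammer ℝ N).eval (σ - X) * ∑' n, residueTerm (σ + N) X n)
    (fun N => sub_eq_of_eq_add (tsum_residueTerm_eq_sum_add hσ hX N)) ?_
  nth_rw 2 [← sub_zero (∑' n, residueTerm σ X n)]
  refine tendsto_const_nhds.sub (squeeze_zero_norm'
    (a := fun N : ℕ => 4 * ‖(-X) ^ N / (ascPochhammer ℝ (N + 1)).eval (σ - X)‖) ?_
    (by simpa using hT.tendsto_atTop_zero.norm.const_mul 4))
  filter_upwards [eventually_ge_atTop ⌈2 * |X|⌉₊] with N hN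
  have hN : 2 * |X| ≤ σ + N := by linarith [Nat.le_of_ceil_le hN]
  have hpos : 0 < σ + N := by positivity
  have hb := norm_tsum_residueTerm_le hpos hN
  have hle : ‖σ - X + N‖ ≤ 2 * (σ + N) := by
    rw [Real.norm_eq_abs, abs_le]
    constructor <;> linarith [le_abs_self X, neg_abs_le X]
  have h1 := hs N
  rw [ascPochhammer_succ_eval, ← mul_div_mul_right _ _ h1, mul_div_right_comm, norm_mul, norm_mul,
    mul_comm (4 : ℝ), mul_assoc]
  refine mul_le_mul_of_nonneg_left ?_ (norm_nonneg _)
  calc _ ≤ 2 * (σ + N) * (2 * (1 / (σ + N))) := by gcongr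
    _ = 4 := by field_simp; norm_num

/-- partial-fraction/residue expansion of the Kummer function:
`Σ_n ((σ+n)^n e^{−(σ+n)}/n!) / (σ+n−X) = (1/(σ−X)) Φ(1, σ−X+1; −X)`. -/
theorem residue_expansion_kummer (σ X : ℝ) (hσ : 0 < σ) (hX : ∀ n : ℕ, X ≠ σ + n) :
    HasSum
      (fun n : ℕ => (σ + n) ^ n * Real.exp (-(σ + n)) / n.factorial * (1 / (σ + n - X)))
      (1 / (σ - X) * kummerPhi 1 (σ - X + 1) (-X)) := by
  rw [one_div_mul_kummerPhi_one, ← tsum_residueTerm hσ hX]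
  exact (summable_residueTerm X hσ).hasSum
end
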